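/- Let D be an n-atomic domain. Then D is an n-UFD if and only if S(a) ∗ S(b) = S(ab) for every a, b ∈ D^#; explicitly, if and only if for all a, b ∈ D^#: (i) an irreducible element of D divides ab exactly when it divides a or divides b, and (ii) a finite set C of pairwise nonassociate irreducible divisors of ab is a face of S(ab) exactly when C = A ∪ B for some face A of S(a) and some face B of S(b). -/

import Mathlib

/-- `a` is a nonzero nonunit (membership in `D^#`). -/
def NNU {D : Type*} [Ring D] (a : D) : Prop := a ≠ 0 ∧ ¬ IsUnit a

/-- `a ∣ b` in the sense of the paper: `b = c * a * d` for some `c, d`. -/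
def PDvd {D : Type*} [Ring D] (a b : D) : Prop := ∃ c d : D, b = c * a * d

/-- `a ~ b`: `a = u * b * v` for units `u, v`. -/
def PAssoc {D : Type*} [Ring D] (a b : D) : Prop :=
  ∃ u v : Dˣ, a = (u : D) * b * (v : D)

/-- `a` is irreducible: a nonzero nonunit that is not a product of two nonunits. -/
def PIrred {D : Type*} [Ring D] (a : D) : Prop :=
  NNU a ∧ ∀ y z : D, a = y * z → IsUnit y ∨ IsUnit z

/-- `a` is normal: `aD = Da`. -/
def PNormal {D : Type*} [Ring D] (a : D) : Prop :=
  {x : D | ∃ d : D, x = a * d} = {x : D | ∃ d : D, x = d * a}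
/-- `D` is n-atomic: every nonzero nonunit is a product of normal irreducible elements. -/
def NAtomic (D : Type*) [Ring D] : Prop :=
  ∀ a : D, NNU a → ∃ l : List D, l ≠ [] ∧ (∀ p ∈ l, PNormal p ∧ PIrred p) ∧ a = l.prod

/-- A factorization of `r` into normal irreducible elements. -/
def NFactorization {D : Type*} [Ring D] (r : D) (l : List D) : Prop :=
  (∀ p ∈ l, PNormal p ∧ PIrred p) ∧ r = l.prod

/-- `D` is an n-UFD: n-atomic, and factorizations into normal irreducibles are
unique up to order and associates. -/
def NUFD (D : Type*) [Ring D] : Prop :=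
  NAtomic D ∧ ∀ r : D, NNU r → ∀ l t : List D, NFactorization r l → NFactorization r t →
    ∃ σ : Fin l.length ≃ Fin t.length, ∀ i, PAssoc (l.get i) (t.get (σ i))
/-- `A` is a face of the irreducible divisor simplicial complex `S x`:
a finite set of pairwise nonassociate irreducible divisors of `x`, some ordering
of which has product dividing `x`. -/
def IsFace {D : Type*} [Ring D] (x : D) (A : Finset D) : Prop :=
  (∀ a ∈ A, PIrred a ∧ PDvd a x) ∧
  (∀ a ∈ A, ∀ b ∈ A, a ≠ b → ¬ PAssoc a b) ∧
  ∃ l : List D, l.Nodup ∧ (∀ a : D, a ∈ l ↔ a ∈ A) ∧ PDvd l.prod x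

theorem PAssoc.refl {D : Type*} [Ring D] (a : D) : PAssoc a a := ⟨1, 1, by simp⟩

theorem PAssoc.symm {D : Type*} [Ring D] {a b : D} (h : PAssoc a b) : PAssoc b a := by
  obtain ⟨u, v, rfl⟩ := h
  exact ⟨u⁻¹, v⁻¹, by simp [mul_assoc]⟩

theorem PAssoc.trans {D : Type*} [Ring D] {a b c : D} (h : PAssoc a b) (h' : PAssoc b c) :
    PAssoc a c := by
  obtain ⟨u, v, rfl⟩ := h
  obtain ⟨u', v', rfl⟩ := h'
  exact ⟨u * u', v' * v, by simp [mul_assoc]⟩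

theorem PNormal.exists_left {D : Type*} [Ring D] {a : D} (h : PNormal a) (x : D) :
    ∃ y, a * x = y * a := by
  have hx : a * x ∈ {z : D | ∃ d : D, z = a * d} := ⟨x, rfl⟩
  rw [h] at hx
  exact hx

theorem PNormal.exists_right {D : Type*} [Ring D] {a : D} (h : PNormal a) (x : D) :
    ∃ y, x * a = a * y := by
  have hx : x * a ∈ {z : D | ∃ d : D, z = d * a} := ⟨x, rfl⟩
  rw [← h] at hx
  exact hx

theorem pNormal_of_forall {D : Type*} [Ring D] {a : D} (hl : ∀ x, ∃ y, a * x = y * a)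
    (hr : ∀ x, ∃ y, x * a = a * y) : PNormal a := by
  ext z
  constructor
  · rintro ⟨d, rfl⟩
    exact hl d
  · rintro ⟨d, rfl⟩
    exact hr d

theorem pNormal_of_isUnit {D : Type*} [Ring D] {a : D} (h : IsUnit a) : PNormal a := by
  obtain ⟨u, rfl⟩ := h
  exact pNormal_of_forall (fun x => ⟨u * x * (u⁻¹ : Dˣ), by simp [mul_assoc]⟩)
    fun x => ⟨(u⁻¹ : Dˣ) * x * u, by simp [← mul_assoc]⟩

theorem PNormal.mul {D : Type*} [Ring D] {a b : D} (ha : PNormal a) (hb : PNormal b) :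
    PNormal (a * b) := by
  refine pNormal_of_forall (fun x => ?_) fun x => ?_
  · obtain ⟨y, hy⟩ := hb.exists_left x
    obtain ⟨z, hz⟩ := ha.exists_left y
    exact ⟨z, by rw [mul_assoc, hy, ← mul_assoc, hz, mul_assoc]⟩
  · obtain ⟨y, hy⟩ := ha.exists_right x
    obtain ⟨z, hz⟩ := hb.exists_right y
    exact ⟨z, by rw [← mul_assoc, hy, mul_assoc, hz, mul_assoc]⟩

theorem pNormal_list_prod {D : Type*} [Ring D] {l : List D} (h : ∀ p ∈ l, PNormal p) :
    PNormal l.prod := by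
  induction l with
  | nil => exact pNormal_of_isUnit (by simp)
  | cons p l ih =>
    rw [List.prod_cons]
    exact (h p (by simp)).mul (ih fun q hq => h q (by simp [hq]))

/-- In an n-atomic ring every element is normal. -/
theorem NAtomic.pNormal {D : Type*} [Ring D] (hat : NAtomic D) (a : D) : PNormal a := by
  by_cases h0 : a = 0
  · exact pNormal_of_forall (fun x => ⟨0, by simp [h0]⟩) fun x => ⟨0, by simp [h0]⟩
  by_cases hu : IsUnit a
  · exact pNormal_of_isUnit hu
  obtain ⟨l, -, hl, rfl⟩ := hat a ⟨h0, hu⟩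
  exact pNormal_list_prod fun p hp => (hl p hp).1

theorem pDvd_iff_right {D : Type*} [Ring D] (hn : ∀ a : D, PNormal a) {a b : D} :
    PDvd a b ↔ ∃ c, b = a * c := by
  constructor
  · rintro ⟨c, d, rfl⟩
    obtain ⟨c', h⟩ := (hn a).exists_right c
    exact ⟨c' * d, by rw [h, mul_assoc]⟩
  · rintro ⟨c, rfl⟩
    exact ⟨1, c, by simp⟩

theorem pDvd_list_prod_of_mem {D : Type*} [Ring D] {l : List D} {p : D} (h : p ∈ l) :
    PDvd p l.prod := by
  obtain ⟨s, t, rfl⟩ := List.append_of_mem h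
  exact ⟨s.prod, t.prod, by simp [mul_assoc]⟩

theorem PDvd.mul_right {D : Type*} [Ring D] (hn : ∀ a : D, PNormal a) {y a : D} (h : PDvd y a)
    (b : D) : PDvd y (a * b) := by
  obtain ⟨c, rfl⟩ := (pDvd_iff_right hn).1 h
  exact (pDvd_iff_right hn).2 ⟨c * b, mul_assoc _ _ _⟩

theorem PDvd.mul_left {D : Type*} [Ring D] {y b : D} (h : PDvd y b) (a : D) : PDvd y (a * b) := by
  obtain ⟨c, d, rfl⟩ := h
  exact ⟨a * c, d, by simp [mul_assoc]⟩

theorem PAssoc.pDvd_of_pDvd {D : Type*} [Ring D] {a b c : D} (h : PAssoc a b) (h' : PDvd b c) :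
    PDvd a c := by
  obtain ⟨u, v, rfl⟩ := h.symm
  obtain ⟨d, e, rfl⟩ := h'
  exact ⟨d * u, v * e, by simp [mul_assoc]⟩

section Duo

variable {D : Type*} [Ring D] [IsDomain D]

theorem isUnit_left_of_mul {a b : D} (h : IsUnit (a * b)) : IsUnit a := by
  obtain ⟨u, hu⟩ := h
  exact IsUnit.of_mul_eq_one (b * (u⁻¹ : Dˣ)) (by rw [← mul_assoc, ← hu, Units.mul_inv])

theorem isUnit_right_of_mul {a b : D} (h : IsUnit (a * b)) : IsUnit b := by
  obtain ⟨u, hu⟩ := h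
  exact IsUnit.of_mul_eq_one_right ((u⁻¹ : Dˣ) * a) (by rw [mul_assoc, ← hu, Units.inv_mul])

theorem NNU.mul {a b : D} (ha : NNU a) (hb : NNU b) : NNU (a * b) :=
  ⟨mul_ne_zero ha.1 hb.1, fun h => ha.2 (isUnit_left_of_mul h)⟩

theorem PIrred.pAssoc_of_pDvd {x y : D} (hx : PIrred x) (hy : PIrred y) (h : PDvd y x) :
    PAssoc y x := by
  obtain ⟨c, d, rfl⟩ := h
  rcases hx.2 _ _ rfl with h | h
  · exact absurd (isUnit_right_of_mul h) hy.1.2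
  obtain ⟨v, rfl⟩ := h
  rcases hx.2 c (y * v) (mul_assoc _ _ _) with h | h
  · obtain ⟨u, rfl⟩ := h
    exact PAssoc.symm ⟨u, v, rfl⟩
  · exact absurd (isUnit_left_of_mul h) hy.1.2

/-- A unit can be moved to the left past any element. -/
theorem exists_unit_mul_eq (hn : ∀ a : D, PNormal a) (b : D) (v : Dˣ) :
    ∃ w : Dˣ, b * (v : D) = w * b := by
  by_cases hb : b = 0
  · exact ⟨1, by simp [hb]⟩
  obtain ⟨w, hw⟩ := (hn b).exists_left v
  obtain ⟨w', hw'⟩ := (hn b).exists_left (v⁻¹ : Dˣ)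
  have h : w * w' = 1 := by
    apply mul_right_cancel₀ hb
    rw [mul_assoc, ← hw', ← mul_assoc, ← hw, Units.mul_inv_cancel_right, one_mul]
  exact ⟨Units.mkOfMulEqOne w w' h, by simpa using hw⟩

theorem PAssoc.mul (hn : ∀ a : D, PNormal a) {a b a' b' : D} (h : PAssoc a b)
    (h' : PAssoc a' b') : PAssoc (a * a') (b * b') := by
  obtain ⟨u, v, rfl⟩ := h
  obtain ⟨u', v', rfl⟩ := h'
  obtain ⟨w, hw⟩ := exists_unit_mul_eq hn b (v * u')
  refine ⟨u * w, v', ?_⟩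
  calc (u : D) * b * v * (u' * b' * v') = u * (b * ((v * u' : Dˣ) : D)) * b' * v' := by
        simp [mul_assoc]
    _ = _ := by rw [hw]; simp [mul_assoc]

theorem PIrred.of_mul_eq_mul (hn : ∀ a : D, PNormal a) {a b b' : D} (ha : a ≠ 0)
    (hb : PIrred b) (h : a * b = b' * a) : PIrred b' := by
  have key : ∀ {y y' : D}, y * a = a * y' → IsUnit y' → IsUnit y := by
    rintro y _ hy ⟨v, rfl⟩
    obtain ⟨w, hw⟩ := exists_unit_mul_eq hn a v
    rw [hw] at hy
    rw [mul_right_cancel₀ ha hy]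
    exact w.isUnit
  refine ⟨⟨?_, ?_⟩, ?_⟩
  · rintro rfl
    exact mul_ne_zero ha hb.1.1 (by simpa using h)
  · rintro ⟨u, rfl⟩
    obtain ⟨c, hc⟩ := (hn a).exists_right u
    obtain ⟨c', hc'⟩ := (hn a).exists_right (u⁻¹ : Dˣ)
    have hcb : b = c := mul_left_cancel₀ ha (h.trans hc)
    refine hb.1.2 (IsUnit.of_mul_eq_one c' (mul_left_cancel₀ ha ?_))
    rw [← mul_assoc, h, mul_assoc, ← hc', Units.mul_inv_cancel_left, mul_one]
  · rintro y z rfl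
    obtain ⟨y', hy⟩ := (hn a).exists_right y
    obtain ⟨z', hz⟩ := (hn a).exists_right z
    have : b = y' * z' := by
      apply mul_left_cancel₀ ha
      rw [h, mul_assoc, hz, ← mul_assoc, hy, mul_assoc]
    exact (hb.2 _ _ this).imp (key hy) (key hz)

end Duo

/-- Every irreducible element dividing a product of two nonzero nonunits divides a factor. -/
def IrredDvdFactor (D : Type*) [Ring D] : Prop :=
  ∀ a b : D, NNU a → NNU b → ∀ y : D, PIrred y → PDvd y (a * b) → PDvd y a ∨ PDvd y b

section Commutation

variable {D : Type*} [Ring D] [IsDomain D]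

theorem NUFD.irredDvdFactor (h : NUFD D) : IrredDvdFactor D := by
  intro a b ha hb y hy hdvd
  have hn := h.1.pNormal
  obtain ⟨e, he⟩ := (pDvd_iff_right hn).1 hdvd
  have hab := ha.mul hb
  have hne : NNU e := by
    refine ⟨?_, fun hu => ?_⟩
    · rintro rfl
      exact hab.1 (by simpa using he)
    · obtain ⟨v, rfl⟩ := hu
      have : y = a * (b * (v⁻¹ : Dˣ)) := by rw [← mul_assoc, he, Units.mul_inv_cancel_right]
      exact (hy.2 _ _ this).elim ha.2 fun hu' => hb.2 (isUnit_left_of_mul hu')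
  obtain ⟨la, -, hla, rfl⟩ := h.1 a ha
  obtain ⟨lb, -, hlb, rfl⟩ := h.1 b hb
  obtain ⟨le, -, hle, rfl⟩ := h.1 e hne
  obtain ⟨σ, hσ⟩ := h.2 _ hab (y :: le) (la ++ lb)
    ⟨by
      intro p hp
      rcases List.mem_cons.1 hp with rfl | hp
      · exact ⟨hn _, hy⟩
      · exact hle p hp, by simpa using he⟩
    ⟨by
      intro p hp
      exact (List.mem_append.1 hp).elim (hla p) (hlb p), by simp⟩
  have h0 : PAssoc y _ := hσ ⟨0, by simp⟩
  have hm := List.get_mem (la ++ lb) (σ ⟨0, by simp⟩)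
  exact (List.mem_append.1 hm).imp (fun hm => h0.pDvd_of_pDvd (pDvd_list_prod_of_mem hm))
    fun hm => h0.pDvd_of_pDvd (pDvd_list_prod_of_mem hm)

theorem IrredDvdFactor.pAssoc_mul_comm_of_pIrred (hn : ∀ a : D, PNormal a)
    (h : IrredDvdFactor D) {a b : D} (ha : PIrred a) (hb : PIrred b) :
    PAssoc (a * b) (b * a) := by
  obtain ⟨b', hb'⟩ := (hn a).exists_left b
  have hirr := hb.of_mul_eq_mul hn ha.1.1 hb'
  suffices PAssoc b' b by
    rw [hb']
    exact this.mul hn (PAssoc.refl a)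
  rcases h a b ha.1 hb.1 b' hirr ⟨1, a, by simpa using hb'⟩ with h1 | h1
  · have hba := ha.pAssoc_of_pDvd hirr h1
    rcases h b' a hirr.1 ha.1 b hb ⟨a, 1, by simp [hb']⟩ with h2 | h2
    · exact (hirr.pAssoc_of_pDvd hb h2).symm
    · exact hba.trans (ha.pAssoc_of_pDvd hb h2).symm
  · exact hb.pAssoc_of_pDvd hirr h1

theorem pAssoc_mul_list_prod_comm (hn : ∀ a : D, PNormal a) {a : D} {l : List D}
    (h : ∀ p ∈ l, PAssoc (a * p) (p * a)) : PAssoc (a * l.prod) (l.prod * a) := by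
  induction l with
  | nil => simpa using PAssoc.refl a
  | cons p l ih =>
    have h1 := (h p (by simp)).mul hn (PAssoc.refl l.prod)
    have h2 := (PAssoc.refl p).mul hn (ih fun q hq => h q (by simp [hq]))
    rw [← mul_assoc] at h2
    simpa [mul_assoc] using h1.trans h2

/-- If irreducibles are prime, multiplication commutes up to associates. -/
theorem IrredDvdFactor.pAssoc_mul_comm (hat : NAtomic D) (h : IrredDvdFactor D) (a b : D) :
    PAssoc (a * b) (b * a) := by
  have hn := hat.pNormal
  have comm_of_irred : ∀ x : D, (∀ p, PIrred p → PAssoc (x * p) (p * x)) → ∀ y,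
      PAssoc (x * y) (y * x) := by
    intro x hx y
    by_cases h0 : y = 0
    · simpa [h0] using PAssoc.refl (0 : D)
    by_cases hu : IsUnit y
    · obtain ⟨u, rfl⟩ := hu
      exact ⟨u⁻¹, u, by simp⟩
    obtain ⟨l, -, hl, rfl⟩ := hat y ⟨h0, hu⟩
    exact pAssoc_mul_list_prod_comm hn fun p hp => hx p (hl p hp).2
  refine comm_of_irred a (fun p hp => (comm_of_irred p (fun q hq => ?_) a).symm) b
  exact h.pAssoc_mul_comm_of_pIrred hn hp hq

end Commutation

/-- The relation of being associates, as a setoid. -/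
def pAssocSetoid (D : Type*) [Ring D] : Setoid D :=
  ⟨PAssoc, PAssoc.refl, PAssoc.symm, PAssoc.trans⟩

/-- Association classes of elements of `D`. -/
def AssocClass (D : Type*) [Ring D] : Type _ := Quotient (pAssocSetoid D)

/-- The association class of an element. -/
def AssocClass.mk {D : Type*} [Ring D] (a : D) : AssocClass D := Quotient.mk (pAssocSetoid D) a

theorem AssocClass.mk_eq_mk {D : Type*} [Ring D] {a b : D} :
    AssocClass.mk a = AssocClass.mk b ↔ PAssoc a b :=
  Quotient.eq (r := pAssocSetoid D)

/-- Association classes form a commutative monoid with zero when all elements are normal and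
multiplication commutes up to associates. -/
abbrev AssocClass.commMonoidWithZero {D : Type*} [Ring D] [IsDomain D]
    (hn : ∀ a : D, PNormal a) (hc : ∀ a b : D, PAssoc (a * b) (b * a)) :
    CommMonoidWithZero (AssocClass D) where
  mul := Quotient.map₂ (· * ·) fun _ _ h _ _ h' => PAssoc.mul hn h h'
  one := AssocClass.mk 1
  zero := AssocClass.mk 0
  mul_assoc := by
    rintro ⟨a⟩ ⟨b⟩ ⟨c⟩
    exact congrArg AssocClass.mk (mul_assoc a b c)
  one_mul := by
    rintro ⟨a⟩
    exact congrArg AssocClass.mk (one_mul a)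
  mul_one := by
    rintro ⟨a⟩
    exact congrArg AssocClass.mk (mul_one a)
  mul_comm := by
    rintro ⟨a⟩ ⟨b⟩
    exact AssocClass.mk_eq_mk.2 (hc a b)
  zero_mul := by
    rintro ⟨a⟩
    exact congrArg AssocClass.mk (zero_mul a)
  mul_zero := by
    rintro ⟨a⟩
    exact congrArg AssocClass.mk (mul_zero a)

/-- Two lists whose images under `f` are permutations of each other have a matching of indices. -/
theorem List.Perm.exists_equiv_of_map {α β : Type*} {f : α → β} {l t : List α}
    (h : (l.map f).Perm (t.map f)) :
    ∃ σ : Fin l.length ≃ Fin t.length, ∀ i, f (l.get i) = f (t.get (σ i)) := by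
  classical
  have hmap : ∀ s : List α, (Finset.univ.val.map fun i => f (s.get i)) =
      ((s.map f : List β) : Multiset β) := by
    intro s
    have : (Finset.univ : Finset (Fin s.length)).val = (List.finRange s.length : Multiset _) := rfl
    rw [this, Multiset.map_coe]
    congr 1
    apply List.ext_getElem <;> simp
  have hcard : ∀ (s : List α) (c : β), Fintype.card {i // f (s.get i) = c} =
      Multiset.count c ((s.map f : List β) : Multiset β) := by
    intro s c
    rw [← hmap, Multiset.count_map, Fintype.card_subtype]
    simp only [Finset.card_def, Finset.filter_val, eq_comm]
  have e : ∀ c : β, Nonempty ({i // f (l.get i) = c} ≃ {i // f (t.get i) = c}) := by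
    intro c
    rw [← Fintype.card_eq, hcard, hcard, Multiset.coe_eq_coe.2 h]
  let e := fun c => (e c).some
  exact ⟨Equiv.ofFiberEquiv e, fun i =>
    (Equiv.ofFiberEquiv_map (f := fun i => f (l.get i)) (g := fun i => f (t.get i)) e i).symm⟩

section Prime

variable {D : Type*} [Ring D] [IsDomain D]

/-- The monoid structure on association classes when irreducibles are prime. -/
abbrev IrredDvdFactor.commMonoidWithZero (hat : NAtomic D) (h : IrredDvdFactor D) :
    CommMonoidWithZero (AssocClass D) :=
  AssocClass.commMonoidWithZero hat.pNormal (h.pAssoc_mul_comm hat)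

namespace AssocClass

variable (hat : NAtomic D) (h : IrredDvdFactor D)

theorem mk_mul (a b : D) :
    letI := h.commMonoidWithZero hat
    mk (a * b) = mk a * mk b := rfl

theorem mk_list_prod (l : List D) :
    letI := h.commMonoidWithZero hat
    mk l.prod = (l.map mk).prod := by
  let _ := h.commMonoidWithZero hat
  induction l with
  | nil => rfl
  | cons p l ih => rw [List.prod_cons, mk_mul hat h, ih, List.map_cons, List.prod_cons]

theorem mk_eq_zero {a : D} :
    letI := h.commMonoidWithZero hat
    mk a = 0 ↔ a = 0 := by
  let _ := h.commMonoidWithZero hat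
  constructor
  · intro h0
    obtain ⟨u, v, huv⟩ := mk_eq_mk.1 (h0 : mk a = mk 0)
    simpa using huv
  · rintro rfl
    rfl

theorem mk_dvd_mk {a b : D} :
    letI := h.commMonoidWithZero hat
    mk a ∣ mk b ↔ PDvd a b := by
  let _ := h.commMonoidWithZero hat
  constructor
  · rintro ⟨⟨c⟩, hc⟩
    obtain ⟨u, v, huv⟩ := mk_eq_mk.1 (hc : mk b = mk (a * c))
    exact ⟨u, c * v, by simp [huv, mul_assoc]⟩
  · intro hd
    obtain ⟨c, rfl⟩ := (pDvd_iff_right hat.pNormal).1 hd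
    exact ⟨mk c, rfl⟩

theorem isUnit_of_isUnit_mk {a : D} :
    letI := h.commMonoidWithZero hat
    IsUnit (mk a) → IsUnit a := by
  let _ := h.commMonoidWithZero hat
  intro hu
  have h1 : PDvd a 1 := (mk_dvd_mk hat h).1 (isUnit_iff_dvd_one.1 hu)
  obtain ⟨c, hc⟩ := (pDvd_iff_right hat.pNormal).1 h1
  exact IsUnit.of_mul_eq_one c hc.symm

theorem mk_eq_one_of_isUnit {a : D} (hu : IsUnit a) :
    letI := h.commMonoidWithZero hat
    mk a = 1 := by
  obtain ⟨u, rfl⟩ := hu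
  exact mk_eq_mk.2 ⟨u, 1, by simp⟩

theorem isCancelMulZero :
    letI := h.commMonoidWithZero hat
    IsCancelMulZero (AssocClass D) := by
  let _ := h.commMonoidWithZero hat
  have : IsLeftCancelMulZero (AssocClass D) := by
    refine ⟨?_⟩
    rintro ⟨a⟩ ha ⟨b⟩ ⟨c⟩ hbc
    have ha' : a ≠ 0 := fun h0 => ha ((mk_eq_zero hat h).2 h0)
    obtain ⟨u, v, huv⟩ := mk_eq_mk.1 (hbc : mk (a * b) = mk (a * c))
    obtain ⟨d, hd⟩ := (hat.pNormal a).exists_right u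
    obtain ⟨d', hd'⟩ := (hat.pNormal a).exists_right (u⁻¹ : Dˣ)
    have hdd : d * d' = 1 := by
      apply mul_left_cancel₀ ha'
      rw [← mul_assoc, ← hd, mul_assoc, ← hd', Units.mul_inv_cancel_left, mul_one]
    refine mk_eq_mk.2 ⟨Units.mkOfMulEqOne d d' hdd, v, mul_left_cancel₀ ha' ?_⟩
    calc a * b = u * a * c * v := by simpa [mul_assoc] using huv
      _ = a * (d * c * v) := by rw [hd]; simp [mul_assoc]
  exact { this with toIsRightCancelMulZero := IsLeftCancelMulZero.to_isRightCancelMulZero }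

theorem subsingleton_units :
    letI := h.commMonoidWithZero hat
    Subsingleton (AssocClass D)ˣ := by
  let _ := h.commMonoidWithZero hat
  have hone : ∀ u : (AssocClass D)ˣ, u = 1 := by
    intro u
    obtain ⟨a, ha⟩ := Quotient.exists_rep (u : AssocClass D)
    change mk a = u at ha
    ext
    rw [← ha]
    exact mk_eq_one_of_isUnit hat h (isUnit_of_isUnit_mk hat h (ha ▸ u.isUnit))
  exact ⟨fun u v => (hone u).trans (hone v).symm⟩

theorem prime_mk {y : D} (hy : PIrred y) :
    letI := h.commMonoidWithZero hat
    Prime (mk y) := by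
  let _ := h.commMonoidWithZero hat
  refine ⟨fun h0 => hy.1.1 ((mk_eq_zero hat h).1 h0),
    fun hu => hy.1.2 (isUnit_of_isUnit_mk hat h hu), ?_⟩
  rintro ⟨a⟩ ⟨b⟩ hd
  change mk y ∣ mk a * mk b at hd
  change mk y ∣ mk a ∨ mk y ∣ mk b
  by_cases ha : a = 0
  · exact .inl ((mk_eq_zero hat h).2 ha ▸ dvd_zero _)
  by_cases hb : b = 0
  · exact .inr ((mk_eq_zero hat h).2 hb ▸ dvd_zero _)
  by_cases hua : IsUnit a
  · rw [mk_eq_one_of_isUnit hat h hua, one_mul] at hd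
    exact .inr hd
  by_cases hub : IsUnit b
  · rw [mk_eq_one_of_isUnit hat h hub, mul_one] at hd
    exact .inl hd
  rw [← mk_mul hat h, mk_dvd_mk hat h] at hd
  rw [mk_dvd_mk hat h, mk_dvd_mk hat h]
  exact h a b ⟨ha, hua⟩ ⟨hb, hub⟩ y hy hd

end AssocClass

theorem IrredDvdFactor.nUFD (hat : NAtomic D) (h : IrredDvdFactor D) : NUFD D := by
  let _ := h.commMonoidWithZero hat
  have := AssocClass.isCancelMulZero hat h
  have := AssocClass.subsingleton_units hat h
  refine ⟨hat, fun r _ l t hl ht => ?_⟩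
  have hprime : ∀ {s : List D}, NFactorization r s →
      ∀ x ∈ ((s.map AssocClass.mk : List (AssocClass D)) : Multiset (AssocClass D)), Prime x := by
    intro s hs x hx
    obtain ⟨p, hp, rfl⟩ := List.mem_map.1 (Multiset.mem_coe.1 hx)
    exact AssocClass.prime_mk hat h (hs.1 p hp).2
  have hrel := prime_factors_unique (hprime hl) (hprime ht) (by
    rw [Multiset.prod_coe, Multiset.prod_coe, ← AssocClass.mk_list_prod hat h,
      ← AssocClass.mk_list_prod hat h, ← hl.2, ← ht.2])
  simp only [associated_eq_eq, Multiset.rel_eq, Multiset.coe_eq_coe] at hrel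
  obtain ⟨σ, hσ⟩ := hrel.exists_equiv_of_map
  exact ⟨σ, fun i => AssocClass.mk_eq_mk.1 (hσ i)⟩

/-- When irreducibles are prime, any finite set of pairwise nonassociate irreducible divisors is
a face. -/
theorem IrredDvdFactor.isFace (hat : NAtomic D) (h : IrredDvdFactor D) {x : D} {A : Finset D}
    (hA : ∀ y ∈ A, PIrred y ∧ PDvd y x) (hne : ∀ y ∈ A, ∀ z ∈ A, y ≠ z → ¬ PAssoc y z) :
    IsFace x A := by
  classical
  let _ := h.commMonoidWithZero hat
  have := AssocClass.isCancelMulZero hat h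
  have := AssocClass.subsingleton_units hat h
  refine ⟨hA, hne, A.toList, A.nodup_toList, fun a => Finset.mem_toList, ?_⟩
  rw [← AssocClass.mk_dvd_mk hat h, AssocClass.mk_list_prod hat h, Finset.prod_map_toList]
  have hinj : Set.InjOn AssocClass.mk (A : Set D) := by
    intro y hy z hz hyz
    by_contra hyz'
    exact hne y hy z hz hyz' (AssocClass.mk_eq_mk.1 hyz)
  have hprod := Finset.prod_image (f := fun q : AssocClass D => q) hinj
  rw [← hprod]
  refine Finset.prod_primes_dvd _ ?_ ?_
  · simp only [Finset.mem_image, forall_exists_index, and_imp]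
    rintro _ y hy rfl
    exact AssocClass.prime_mk hat h (hA y hy).1
  · simp only [Finset.mem_image, forall_exists_index, and_imp]
    rintro _ y hy rfl
    exact (AssocClass.mk_dvd_mk hat h).2 (hA y hy).2

end Prime

/-- An n-atomic domain is an n-UFD iff `S(a) ∗ S(b) = S(ab)` for all
`a, b ∈ D^#`: (i) an irreducible divides `ab` exactly when it divides `a` or `b`,
and (ii) a finite set of pairwise nonassociate irreducible divisors of `ab` is a
face of `S(ab)` exactly when it is `A ∪ B` for a face `A` of `S(a)` and a face `B`
of `S(b)`. -/
theorem nufd_iff_join {D : Type*} [Ring D] [IsDomain D] [DecidableEq D]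
    (hat : NAtomic D) :
    NUFD D ↔ ∀ a b : D, NNU a → NNU b →
      (∀ y : D, PIrred y → (PDvd y (a * b) ↔ PDvd y a ∨ PDvd y b)) ∧
      (∀ C : Finset D, (∀ y ∈ C, PIrred y ∧ PDvd y (a * b)) →
        (∀ y ∈ C, ∀ z ∈ C, y ≠ z → ¬ PAssoc y z) →
        (IsFace (a * b) C ↔ ∃ A B : Finset D, IsFace a A ∧ IsFace b B ∧ C = A ∪ B)) := by
  have hn := hat.pNormal
  constructor
  · intro hu a b ha hb
    have h := hu.irredDvdFactor
    refine ⟨fun y hy => ⟨h a b ha hb y hy, ?_⟩, fun C hC hne => ⟨fun _ => ?_, fun _ =>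
      h.isFace hat hC hne⟩⟩
    · rintro (hd | hd)
      · exact hd.mul_right hn b
      · exact hd.mul_left a
    · classical
      have hface : ∀ x : D, IsFace x (C.filter fun y => PDvd y x) := fun x =>
        h.isFace hat
          (fun y hy => ⟨(hC y (Finset.mem_filter.1 hy).1).1, (Finset.mem_filter.1 hy).2⟩)
          fun y hy z hz => hne y (Finset.mem_filter.1 hy).1 z (Finset.mem_filter.1 hz).1
      refine ⟨C.filter fun y => PDvd y a, C.filter fun y => PDvd y b, hface a, hface b, ?_⟩
      ext y
      simp only [Finset.mem_union, Finset.mem_filter, ← and_or_left]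
      exact ⟨fun hy => ⟨hy, h a b ha hb y (hC y hy).1 (hC y hy).2⟩, fun hy => hy.1⟩
  · intro h
    exact IrredDvdFactor.nUFD hat fun a b ha hb y hy hd => ((h a b ha hb).1 y hy).1 hd
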